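/- arXiv:math/0401324 — 2 statements merged into one kernel-verified Lean document; each statement's English description precedes it below -/
import Mathlib

section
/- Let W_n be the universal Coxeter group and (t_1,…,t_n) ∈ Red_T(c) with c = s_1⋯s_n. If (t_1,…,t_n) ≠ (s_1,…,s_n), then there is an elementary Hurwitz move producing a tuple (t'_1,…,t'_n) ∈ Red_T(c) with strictly smaller total length ℓ(t'_1)+⋯+ℓ(t'_n) < ℓ(t_1)+⋯+ℓ(t_n). Consequently (s_1,…,s_n) is the unique tuple in Red_T(c) of minimal total length. -/
/-- The elementary Hurwitz move `σ_i` on `n`-tuples of a group `G`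
(0-indexed: acts on entries `i` and `i+1`). -/
def hmove (n : ℕ) (G : Type*) [Group G] (i : ℕ) (hi : i + 1 < n)
    (g : Fin n → G) : Fin n → G := fun j =>
  if (j : ℕ) = i then g ⟨i, by omega⟩ * g ⟨i + 1, hi⟩ * (g ⟨i, by omega⟩)⁻¹
  else if (j : ℕ) = i + 1 then g ⟨i, by omega⟩
  else g j

/-- One elementary step of the Hurwitz action. -/
def hstep (n : ℕ) (G : Type*) [Group G] (a b : Fin n → G) : Prop :=
  ∃ (i : ℕ) (hi : i + 1 < n), b = hmove n G i hi a

/-- Braid relations: generators `σ_1, …, σ_{n-1}` indexed by `Fin (n-1)`. -/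
def braidRels (n : ℕ) : Set (FreeGroup (Fin (n - 1))) :=
  { r | (∃ i j : Fin (n - 1), (i : ℕ) + 1 = (j : ℕ) ∧
          r = FreeGroup.of i * FreeGroup.of j * FreeGroup.of i *
            (FreeGroup.of j * FreeGroup.of i * FreeGroup.of j)⁻¹) ∨
        (∃ i j : Fin (n - 1), (i : ℕ) + 1 < (j : ℕ) ∧
          r = FreeGroup.of i * FreeGroup.of j * (FreeGroup.of j * FreeGroup.of i)⁻¹) }

/-- The braid group `B_n`. -/
abbrev BraidGroup (n : ℕ) := PresentedGroup (braidRels n)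

/-- Relations of the universal Coxeter group: each generator squares to 1. -/
def coxRels (n : ℕ) : Set (FreeGroup (Fin n)) :=
  { r | ∃ i, r = FreeGroup.of i * FreeGroup.of i }

/-- The universal Coxeter group `W_n`. -/
abbrev UCox (n : ℕ) := PresentedGroup (coxRels n)

/-- The generator `s_i` of `W_n`. -/
def sgen {n : ℕ} (i : Fin n) : UCox n := PresentedGroup.of i

/-- The Coxeter element `c = s_1 ⋯ s_n`. -/
def coxElt (n : ℕ) : UCox n := (List.ofFn fun i => sgen i).prod

/-- The set `T` of reflections of `W_n`: conjugates of generators. -/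
def Refl (n : ℕ) : Set (UCox n) := { t | ∃ w i, t = w * sgen i * w⁻¹ }

/-- `Red_T(c)`: `n`-tuples of reflections with product `c`. -/
def RedT (n : ℕ) : Set (Fin n → UCox n) :=
  { t | (∀ i, t i ∈ Refl n) ∧ (List.ofFn t).prod = coxElt n }

/-- The set `R` of braid reflections of the free group: conjugates of generators. -/
def Rset (n : ℕ) : Set (FreeGroup (Fin n)) :=
  { r | ∃ w i, r = w * FreeGroup.of i * w⁻¹ }

/-- `g = f_1 ⋯ f_n`. -/
def gElt (n : ℕ) : FreeGroup (Fin n) := (List.ofFn fun i => FreeGroup.of i).prod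

/-- `Red_R(g)`: `n`-tuples from `R` with product `g`. -/
def RedR (n : ℕ) : Set (Fin n → FreeGroup (Fin n)) :=
  { t | (∀ i, t i ∈ Rset n) ∧ (List.ofFn t).prod = gElt n }

/-- The canonical projection `π : F_n → W_n`, `f_i ↦ s_i`. -/
def pr (n : ℕ) : FreeGroup (Fin n) →* UCox n := FreeGroup.lift fun i => sgen i

/-- Length of an element of `W_n`: the length of its normal form. -/
noncomputable def wordLength {n : ℕ} (w : UCox n) : ℕ :=
  sInf { m | ∃ l : List (Fin n),
    List.Chain' (· ≠ ·) l ∧ l.length = m ∧ (l.map sgen).prod = w }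

/-- The inverse elementary Hurwitz move: `(t_i, t_{i+1}) ↦ (t_{i+1}, t_{i+1}⁻¹ t_i t_{i+1})`. -/
def hmoveInv (n : ℕ) (G : Type*) [Group G] (i : ℕ) (hi : i + 1 < n)
    (g : Fin n → G) : Fin n → G := fun j =>
  if (j : ℕ) = i then g ⟨i + 1, hi⟩
  else if (j : ℕ) = i + 1 then (g ⟨i + 1, hi⟩)⁻¹ * g ⟨i, by omega⟩ * g ⟨i + 1, hi⟩
  else g j

namespace UCox

variable {n : ℕ}

/-- The element of `W_n` spelled by a word in the generators. -/
def ofWord (l : List (Fin n)) : UCox n := (l.map sgen).prod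

/-- A word is reduced when no letter is repeated consecutively. -/
abbrev Reduced (l : List (Fin n)) : Prop := l.IsChain (· ≠ ·)

theorem sgen_mul_self (i : Fin n) : sgen i * sgen i = 1 :=
  PresentedGroup.one_of_mem (rels := coxRels n) ⟨i, rfl⟩

theorem sgen_inv (i : Fin n) : (sgen i)⁻¹ = sgen i :=
  inv_eq_of_mul_eq_one_left (sgen_mul_self i)

@[simp] theorem ofWord_nil : ofWord ([] : List (Fin n)) = 1 := rfl

@[simp] theorem ofWord_cons (i : Fin n) (l : List (Fin n)) :
    ofWord (i :: l) = sgen i * ofWord l := by simp [ofWord]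

@[simp] theorem ofWord_append (l l' : List (Fin n)) :
    ofWord (l ++ l') = ofWord l * ofWord l' := by simp [ofWord]

@[simp] theorem ofWord_reverse (l : List (Fin n)) : ofWord l.reverse = (ofWord l)⁻¹ := by
  induction l with
  | nil => simp
  | cons i l ih => simp [ih, sgen_inv]

theorem ofWord_surjective : Function.Surjective (ofWord (n := n)) := by
  intro w
  have hw : w ∈ Subgroup.closure (Set.range (PresentedGroup.of (rels := coxRels n))) := by
    rw [PresentedGroup.closure_range_of]; trivial
  induction hw using Subgroup.closure_induction with
  | mem x hx =>
    obtain ⟨i, rfl⟩ := hx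
    exact ⟨[i], by simp [sgen]⟩
  | one => exact ⟨[], rfl⟩
  | mul x y _ _ hx hy =>
    obtain ⟨l, rfl⟩ := hx
    obtain ⟨l', rfl⟩ := hy
    exact ⟨l ++ l', by simp⟩
  | inv x _ hx =>
    obtain ⟨l, rfl⟩ := hx
    exact ⟨l.reverse, by simp⟩

/-- Left multiplication by the generator `s_i` on words: cancel or prepend the letter `i`. -/
def toggle (i : Fin n) : List (Fin n) → List (Fin n)
  | [] => [i]
  | j :: l => if i = j then l else i :: j :: l

theorem Reduced.toggle {l : List (Fin n)} (hl : Reduced l) (i : Fin n) :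
    Reduced (toggle i l) := by
  cases l with
  | nil => simp [UCox.toggle]
  | cons j l =>
    by_cases h : i = j
    · simpa [UCox.toggle, h] using hl.tail
    · simpa [UCox.toggle, h] using hl

theorem toggle_toggle {l : List (Fin n)} (hl : Reduced l) (i : Fin n) :
    toggle i (toggle i l) = l := by
  rcases l with _ | ⟨j, _ | ⟨k, l⟩⟩
  · simp [toggle]
  · by_cases h : i = j <;> simp [toggle, h]
  · have hjk : j ≠ k := (List.isChain_cons_cons.1 hl).1
    by_cases h : i = j <;> simp [toggle, h, hjk]

theorem toggle_of_reduced {i : Fin n} {l : List (Fin n)} (h : Reduced (i :: l)) :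
    toggle i l = i :: l := by
  cases l with
  | nil => rfl
  | cons j l => simp [toggle, (List.isChain_cons_cons.1 h).1]

theorem ofWord_toggle (i : Fin n) (l : List (Fin n)) :
    ofWord (toggle i l) = sgen i * ofWord l := by
  cases l with
  | nil => simp [toggle]
  | cons j l =>
    by_cases h : i = j
    · subst h
      simp [toggle, ← mul_assoc, sgen_mul_self]
    · simp [toggle, h]

theorem length_toggle_le (i : Fin n) (l : List (Fin n)) :
    (toggle i l).length ≤ l.length + 1 := by
  cases l with
  | nil => simp [toggle]
  | cons j l => simp only [toggle]; split_ifs <;> simp; omega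

/-- Toggling as a permutation of the reduced words. -/
def togglePerm (i : Fin n) : Equiv.Perm {l : List (Fin n) // Reduced l} where
  toFun l := ⟨toggle i l.1, l.2.toggle i⟩
  invFun l := ⟨toggle i l.1, l.2.toggle i⟩
  left_inv l := Subtype.ext (toggle_toggle l.2 i)
  right_inv l := Subtype.ext (toggle_toggle l.2 i)

/-- The action of `W_n` on reduced words. -/
def act (n : ℕ) : UCox n →* Equiv.Perm {l : List (Fin n) // Reduced l} :=
  PresentedGroup.toGroup (f := togglePerm) (by
    rintro r ⟨i, rfl⟩
    ext1 l
    simpa using Subtype.ext (toggle_toggle l.2 i))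

theorem act_sgen (i : Fin n) : act n (sgen i) = togglePerm i := by
  simp [act, sgen]

theorem act_ofWord {l : List (Fin n)} (hl : Reduced l) :
    act n (ofWord l) ⟨[], .nil⟩ = ⟨l, hl⟩ := by
  induction l with
  | nil => simp
  | cons i l ih =>
    rw [ofWord_cons, map_mul, Equiv.Perm.mul_apply, ih hl.tail, act_sgen]
    exact Subtype.ext (toggle_of_reduced hl)

theorem ofWord_injOn {l l' : List (Fin n)} (hl : Reduced l) (hl' : Reduced l')
    (h : ofWord l = ofWord l') : l = l' := by
  have := act_ofWord hl
  rw [h, act_ofWord hl'] at this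
  exact (congrArg Subtype.val this).symm

theorem wordLength_ofWord {l : List (Fin n)} (hl : Reduced l) :
    wordLength (ofWord l) = l.length := by
  have : {m | ∃ k : List (Fin n), Reduced k ∧ k.length = m ∧
      (k.map sgen).prod = ofWord l} = {l.length} := by
    ext m
    constructor
    · rintro ⟨k, hk, rfl, h⟩
      rw [ofWord_injOn hk hl h]; rfl
    · rintro rfl
      exact ⟨l, hl, rfl, rfl⟩
  exact (congrArg sInf this).trans (csInf_singleton _)

theorem wordLength_ofWord_le (l : List (Fin n)) : wordLength (ofWord l) ≤ l.length := by
  obtain ⟨k, hk, hkl, hlen⟩ : ∃ k, Reduced k ∧ ofWord k = ofWord l ∧ k.length ≤ l.length := by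
    induction l with
    | nil => exact ⟨[], .nil, rfl, le_rfl⟩
    | cons i l ih =>
      obtain ⟨k, hk, hkl, hlen⟩ := ih
      refine ⟨toggle i k, hk.toggle i, by rw [ofWord_toggle, hkl, ofWord_cons], ?_⟩
      have := length_toggle_le i k
      simp only [List.length_cons]
      omega
  rw [← hkl, wordLength_ofWord hk]
  exact hlen

/-- The reflection `u s_a u⁻¹` attached to a word `u` and a letter `a`. -/
def refl (u : List (Fin n)) (a : Fin n) : UCox n := ofWord u * sgen a * (ofWord u)⁻¹

theorem refl_eq_ofWord (u : List (Fin n)) (a : Fin n) :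
    refl u a = ofWord (u ++ a :: u.reverse) := by
  simp [refl, mul_assoc]

theorem refl_mul_self (u : List (Fin n)) (a : Fin n) : refl u a * refl u a = 1 := by
  rw [refl, conj_mul, sgen_mul_self]; simp

theorem refl_inv (u : List (Fin n)) (a : Fin n) : (refl u a)⁻¹ = refl u a :=
  inv_eq_of_mul_eq_one_left (refl_mul_self u a)

theorem reduced_append_cons {u w : List (Fin n)} {a : Fin n} (hu : Reduced (u ++ [a]))
    (hw : Reduced (a :: w)) : Reduced (u ++ a :: w) :=
  List.isChain_split.2 ⟨hu, hw⟩

theorem reduced_cons_reverse {u : List (Fin n)} {a : Fin n} (hu : Reduced (u ++ [a])) :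
    Reduced (a :: u.reverse) := by
  have : Reduced (u ++ [a]).reverse := List.isChain_reverse.2 (hu.imp fun _ _ h => h.symm)
  simpa using this

theorem wordLength_refl {u : List (Fin n)} {a : Fin n} (hu : Reduced (u ++ [a])) :
    wordLength (refl u a) = 2 * u.length + 1 := by
  rw [refl_eq_ofWord, wordLength_ofWord (reduced_append_cons hu (reduced_cons_reverse hu))]
  simp; omega

theorem wordLength_refl_le (u : List (Fin n)) (a : Fin n) :
    wordLength (refl u a) ≤ 2 * u.length + 1 := by
  rw [refl_eq_ofWord]
  refine (wordLength_ofWord_le _).trans_eq ?_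
  simp; omega

theorem exists_refl_of_mem {t : UCox n} (ht : t ∈ Refl n) :
    ∃ u a, Reduced (u ++ [a]) ∧ t = refl u a := by
  obtain ⟨w, i, rfl⟩ := ht
  obtain ⟨l, rfl⟩ := ofWord_surjective w
  induction l with
  | nil => exact ⟨[], i, by simp, by simp [refl]⟩
  | cons j l ih =>
    obtain ⟨u, a, hu, h⟩ := ih
    have hconj : ofWord (j :: l) * sgen i * (ofWord (j :: l))⁻¹ =
        sgen j * refl u a * (sgen j)⁻¹ := by
      rw [← h]; simp [mul_assoc]
    rw [hconj]
    by_cases hj : Reduced (j :: (u ++ [a]))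
    · exact ⟨j :: u, a, hj, by simp [refl, mul_assoc]⟩
    · cases u with
      | nil =>
        obtain rfl : j = a := by simpa using hj
        exact ⟨[], j, hu, by simp [refl]⟩
      | cons k u =>
        obtain rfl : j = k := by
          by_contra hne
          exact hj (List.isChain_cons_cons.2 ⟨hne, hu⟩)
        refine ⟨u, a, hu.tail, ?_⟩
        rw [sgen_inv]
        simp only [refl, ofWord_cons, mul_inv_rev, sgen_inv]
        simp only [mul_assoc, sgen_mul_self, mul_one]
        simp only [← mul_assoc, sgen_mul_self, one_mul]

theorem exists_common_prefix (u v : List (Fin n)) :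
    ∃ g u' v', u = g ++ u' ∧ v = g ++ v' ∧ ∀ x ∈ u'.head?, ∀ y ∈ v'.head?, x ≠ y := by
  induction u generalizing v with
  | nil => exact ⟨[], [], v, by simp⟩
  | cons i u ih =>
    cases v with
    | nil => exact ⟨[], i :: u, [], by simp⟩
    | cons j v =>
      by_cases h : i = j
      · subst h
        obtain ⟨g, u', v', rfl, rfl, hne⟩ := ih v
        exact ⟨i :: g, u', v', rfl, rfl, hne⟩
      · exact ⟨[], i :: u, j :: v, by simp [h]⟩

theorem refl_conj_refl (u v : List (Fin n)) (a b : Fin n) :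
    refl u a * refl (u ++ a :: v) b * (refl u a)⁻¹ = refl (u ++ v) b := by
  simp only [refl, ofWord_append, ofWord_cons, mul_inv_rev, sgen_inv, inv_inv]
  simp only [mul_assoc, inv_mul_cancel_left]
  simp only [← mul_assoc (sgen a) (sgen a), sgen_mul_self, one_mul]

/-- If conjugating by the shorter reflection does not shorten the longer one, then the
longer word does not continue through the central letter of the shorter one. -/
theorem head_ne_of_wordLength_le {u v : List (Fin n)} {a b : Fin n}
    (hv : Reduced ((u ++ v) ++ [b]))
    (h : wordLength (refl (u ++ v) b) ≤
      wordLength (refl u a * refl (u ++ v) b * (refl u a)⁻¹)) :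
    ∀ x ∈ v.head?, a ≠ x := by
  cases v with
  | nil => simp
  | cons x v =>
    simp only [List.head?_cons, Option.mem_def, Option.some.injEq, forall_eq']
    rintro rfl
    rw [refl_conj_refl, wordLength_refl hv] at h
    have := wordLength_refl_le (u ++ v) b
    simp at h this
    omega

/-- When neither Hurwitz move on a pair of reflections with distinct central letters
shortens it, both central letters survive in the product. -/
theorem exists_reduced_between {u v : List (Fin n)} {a b : Fin n}
    (hu : Reduced (u ++ [a])) (hv : Reduced (v ++ [b])) (hab : a ≠ b)
    (h₁ : wordLength (refl v b) ≤ wordLength (refl u a * refl v b * (refl u a)⁻¹))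
    (h₂ : wordLength (refl u a) ≤ wordLength ((refl v b)⁻¹ * refl u a * refl v b)) :
    ∃ d, ofWord d = (ofWord u)⁻¹ * ofWord v ∧ Reduced (a :: (d ++ [b])) := by
  obtain ⟨g, u', v', rfl, rfl, hne⟩ := exists_common_prefix u v
  refine ⟨u'.reverse ++ v', by simp [mul_assoc], ?_⟩
  have hu' : Reduced (a :: u'.reverse) :=
    reduced_cons_reverse
      (List.IsChain.right_of_append (by simpa using hu : Reduced (g ++ (u' ++ [a]))))
  have hv' : Reduced (v' ++ [b]) :=
    List.IsChain.right_of_append (by simpa using hv : Reduced (g ++ (v' ++ [b])))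
  have key : Reduced ((a :: u'.reverse) ++ (v' ++ [b])) := by
    refine List.isChain_append.2 ⟨hu', hv', ?_⟩
    cases u' with
    | nil =>
      cases v' with
      | nil => simpa using hab
      | cons y v' => simpa using head_ne_of_wordLength_le hv (by simpa using h₁) y (by simp)
    | cons x u' =>
      cases v' with
      | nil =>
        have h₂' : wordLength (refl (g ++ x :: u') a) ≤
            wordLength (refl g b * refl (g ++ x :: u') a * (refl g b)⁻¹) := by
          simpa [refl_inv] using h₂
        have := head_ne_of_wordLength_le hu h₂' x (by simp)
        simpa [List.getLast?_cons] using this.symm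
      | cons y v' =>
        have := hne x (by simp) y (by simp)
        simpa [List.getLast?_cons] using this
  simpa using key

/-- In a product of reflections all of whose adjacent pairs are separated by reduced words,
the central letters survive; if nothing else does, all reflections are generators. -/
theorem exists_reduced_prod (p : List (Fin n) × Fin n) (L : List (List (Fin n) × Fin n))
    (hred : ∀ q ∈ p :: L, Reduced (q.1 ++ [q.2]))
    (hL : (p :: L).IsChain fun q r =>
      ∃ d, ofWord d = (ofWord q.1)⁻¹ * ofWord r.1 ∧ Reduced (q.2 :: (d ++ [r.2]))) :
    ∃ w, Reduced (p.2 :: w) ∧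
      ((p :: L).map fun q => refl q.1 q.2).prod = ofWord (p.1 ++ p.2 :: w) ∧
      L.length ≤ w.length ∧
      (w.length = L.length → (∀ q ∈ p :: L, q.1 = []) ∧ w = L.map Prod.snd) := by
  induction L generalizing p with
  | nil =>
    refine ⟨p.1.reverse, reduced_cons_reverse (hred p (by simp)), ?_, by simp, ?_⟩
    · simp [refl_eq_ofWord]
    · intro h
      have : p.1 = [] := by simpa using h
      simp [this]
  | cons q L ih =>
    obtain ⟨w, hw, hprod, hlen, heq⟩ := ih q (fun r hr => hred r (by simp [hr])) hL.tail
    obtain ⟨⟨d, hd, hpd⟩, -⟩ := List.isChain_cons_cons.1 hL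
    refine ⟨d ++ q.2 :: w, ?_, ?_, ?_, ?_⟩
    · exact reduced_append_cons (u := p.2 :: d) hpd hw
    · rw [List.map_cons, List.prod_cons, hprod]
      simp [refl, hd, mul_assoc]
    · simp; omega
    · intro h
      simp only [List.length_append, List.length_cons] at h
      obtain ⟨hnil, rfl⟩ := heq (by omega)
      obtain rfl : d = [] := List.eq_nil_of_length_eq_zero (by omega)
      have hpq : ofWord p.1 = ofWord q.1 := by
        rw [ofWord_nil] at hd
        exact inv_mul_eq_one.1 hd.symm
      have hp : p.1 = q.1 := ofWord_injOn (hred p (by simp)).left_of_append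
        (hred q (by simp)).left_of_append hpq
      rw [hnil q (by simp)] at hp
      simpa [hp] using hnil

/-- The sign character of `W_n` that sees only the generator `s_j`. -/
def signAt (j : Fin n) : UCox n →* ℤˣ :=
  PresentedGroup.toGroup (f := fun i => if i = j then -1 else 1) (by
    rintro r ⟨i, rfl⟩
    by_cases h : i = j <;> simp [h])

theorem signAt_sgen (i j : Fin n) : signAt j (sgen i) = if i = j then -1 else 1 := by
  simp [signAt, sgen]

theorem signAt_refl (u : List (Fin n)) (a j : Fin n) :
    signAt j (refl u a) = if a = j then -1 else 1 := by
  simp [refl, signAt_sgen, mul_comm]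

theorem center_injective {u : Fin n → List (Fin n)} {a : Fin n → Fin n}
    (h : (List.ofFn fun i => refl (u i) (a i)).prod = coxElt n) : Function.Injective a := by
  refine Finite.injective_iff_surjective.2 fun j => ?_
  by_contra hj
  push Not at hj
  have := congrArg (signAt j) h
  simp [coxElt, map_list_prod, List.map_ofFn, List.prod_ofFn, signAt_refl, signAt_sgen, hj] at this

theorem prod_ofFn_congr_pair {G : Type*} [Monoid G] {m : ℕ} {f g : Fin m → G} (i : ℕ)
    (hi : i + 1 < m) (hne : ∀ j : Fin m, (j : ℕ) ≠ i → (j : ℕ) ≠ i + 1 → f j = g j)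
    (h : f ⟨i, by omega⟩ * f ⟨i + 1, hi⟩ = g ⟨i, by omega⟩ * g ⟨i + 1, hi⟩) :
    (List.ofFn f).prod = (List.ofFn g).prod := by
  induction i generalizing m with
  | zero =>
    obtain ⟨m, rfl⟩ := Nat.exists_eq_add_of_le' (show 2 ≤ m by omega)
    simp only [List.ofFn_succ, List.prod_cons, ← mul_assoc]
    congr 1
    congr 2
    funext j
    exact hne _ (by simp) (by simp)
  | succ i ih =>
    obtain ⟨m, rfl⟩ := Nat.exists_eq_add_of_le' (show 1 ≤ m by omega)
    simp only [List.ofFn_succ, List.prod_cons]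
    rw [hne 0 (by simp) (by simp)]
    congr 1
    exact ih (by omega) (fun j h₁ h₂ => hne _ (by simpa using h₁) (by simpa using h₂)) h

theorem sum_lt_sum_of_pair {m : ℕ} {f g : Fin m → ℕ} (i : ℕ)
    (hi : i + 1 < m) (hne : ∀ j : Fin m, (j : ℕ) ≠ i → (j : ℕ) ≠ i + 1 → f j = g j)
    (h : f ⟨i, by omega⟩ + f ⟨i + 1, hi⟩ < g ⟨i, by omega⟩ + g ⟨i + 1, hi⟩) :
    ∑ j, f j < ∑ j, g j := by
  have hij : (⟨i, by omega⟩ : Fin m) ≠ ⟨i + 1, hi⟩ := by simp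
  rw [← Finset.sum_add_sum_compl {⟨i, by omega⟩, ⟨i + 1, hi⟩} f,
    ← Finset.sum_add_sum_compl {⟨i, by omega⟩, ⟨i + 1, hi⟩} g,
    Finset.sum_pair hij, Finset.sum_pair hij]
  refine add_lt_add_of_lt_of_le h (Finset.sum_le_sum fun j hj => (hne j ?_ ?_).le) <;>
  · intro hji
    simp [Fin.ext_iff, hji] at hj

theorem conj_mem_Refl {t : UCox n} (ht : t ∈ Refl n) (w : UCox n) : w * t * w⁻¹ ∈ Refl n := by
  obtain ⟨x, i, rfl⟩ := ht
  exact ⟨w * x, i, by simp [mul_assoc]⟩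

theorem hmove_mem_RedT {t : Fin n → UCox n} (ht : t ∈ RedT n) (i : ℕ) (hi : i + 1 < n) :
    hmove n (UCox n) i hi t ∈ RedT n := by
  refine ⟨fun j => ?_, ?_⟩
  · unfold hmove
    split_ifs
    exacts [conj_mem_Refl (ht.1 _) _, ht.1 _, ht.1 _]
  · rw [← ht.2]
    refine prod_ofFn_congr_pair i hi (fun j h₁ h₂ => by simp [hmove, h₁, h₂]) ?_
    simp [hmove]

theorem hmoveInv_mem_RedT {t : Fin n → UCox n} (ht : t ∈ RedT n) (i : ℕ) (hi : i + 1 < n) :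
    hmoveInv n (UCox n) i hi t ∈ RedT n := by
  refine ⟨fun j => ?_, ?_⟩
  · unfold hmoveInv
    split_ifs
    · exact ht.1 _
    · simpa using conj_mem_Refl (ht.1 ⟨i, by omega⟩) (t ⟨i + 1, hi⟩)⁻¹
    · exact ht.1 _
  · rw [← ht.2]
    refine prod_ofFn_congr_pair i hi (fun j h₁ h₂ => by simp [hmoveInv, h₁, h₂]) ?_
    simp [hmoveInv, mul_assoc]

theorem sum_wordLength_hmove_lt {t : Fin n → UCox n} {i : ℕ} (hi : i + 1 < n)
    (h : wordLength (t ⟨i, by omega⟩ * t ⟨i + 1, hi⟩ * (t ⟨i, by omega⟩)⁻¹) <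
      wordLength (t ⟨i + 1, hi⟩)) :
    ∑ j, wordLength (hmove n (UCox n) i hi t j) < ∑ j, wordLength (t j) := by
  refine sum_lt_sum_of_pair i hi (fun j h₁ h₂ => by simp [hmove, h₁, h₂]) ?_
  simp only [hmove, if_true, Nat.succ_ne_self, if_false]
  omega

theorem sum_wordLength_hmoveInv_lt {t : Fin n → UCox n} {i : ℕ} (hi : i + 1 < n)
    (h : wordLength ((t ⟨i + 1, hi⟩)⁻¹ * t ⟨i, by omega⟩ * t ⟨i + 1, hi⟩) <
      wordLength (t ⟨i, by omega⟩)) :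
    ∑ j, wordLength (hmoveInv n (UCox n) i hi t j) < ∑ j, wordLength (t j) := by
  refine sum_lt_sum_of_pair i hi (fun j h₁ h₂ => by simp [hmoveInv, h₁, h₂]) ?_
  simp only [hmoveInv, if_true, Nat.succ_ne_self, if_false]
  omega

/-- A tuple in `Red_T(c)` that no elementary Hurwitz move shortens is `(s_1,…,s_n)`. -/
theorem eq_sgen_of_forall_wordLength_le {t : Fin n → UCox n} (ht : t ∈ RedT n)
    (h₁ : ∀ (i : ℕ) (hi : i + 1 < n), wordLength (t ⟨i + 1, hi⟩) ≤
      wordLength (t ⟨i, by omega⟩ * t ⟨i + 1, hi⟩ * (t ⟨i, by omega⟩)⁻¹))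
    (h₂ : ∀ (i : ℕ) (hi : i + 1 < n), wordLength (t ⟨i, by omega⟩) ≤
      wordLength ((t ⟨i + 1, hi⟩)⁻¹ * t ⟨i, by omega⟩ * t ⟨i + 1, hi⟩)) :
    t = fun i => sgen i := by
  choose u a hred hta using fun i => exists_refl_of_mem (ht.1 i)
  obtain rfl : t = fun i => refl (u i) (a i) := funext hta
  have ha : Function.Injective a := center_injective ht.2
  have hchain : (List.ofFn fun i => (u i, a i)).IsChain fun q r =>
      ∃ d, ofWord d = (ofWord q.1)⁻¹ * ofWord r.1 ∧ Reduced (q.2 :: (d ++ [r.2])) := by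
    refine List.isChain_ofFn.2 fun i hi => ?_
    exact exists_reduced_between (hred _) (hred _) (ha.ne (by simp)) (h₁ i hi) (h₂ i hi)
  rcases n with _ | m
  · exact Subsingleton.elim _ _
  rw [List.ofFn_succ] at hchain
  obtain ⟨w, hw, hprod, hlen, heq⟩ := exists_reduced_prod _ _ (by
    intro q hq
    rw [← List.ofFn_succ (f := fun i => (u i, a i))] at hq
    obtain ⟨i, rfl⟩ := List.mem_ofFn.1 hq
    exact hred i) hchain
  rw [← List.ofFn_succ (f := fun i => (u i, a i)), List.map_ofFn] at hprod
  have hc : ofWord (List.finRange (m + 1)) = coxElt (m + 1) := by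
    rw [ofWord, coxElt, List.ofFn_eq_map]
  have hword : u 0 ++ a 0 :: w = List.finRange (m + 1) := by
    refine ofWord_injOn (reduced_append_cons (hred 0) hw) ?_ ?_
    · exact (List.nodup_finRange _).isChain
    · rw [hc, ← ht.2]; exact hprod.symm
  have hwlen := congrArg List.length hword
  simp only [List.length_append, List.length_cons, List.length_finRange] at hwlen
  simp only [List.length_ofFn] at hlen heq
  obtain ⟨hnil, rfl⟩ := heq (by omega)
  have hu : ∀ i, u i = [] := fun i => hnil (u i, a i) (by
    rw [← List.ofFn_succ (f := fun i => (u i, a i))]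
    exact List.mem_ofFn.2 ⟨i, rfl⟩)
  have hofFn : List.ofFn a = List.ofFn id := by
    rw [List.ofFn_id, ← hword, List.ofFn_succ, hu 0, List.map_ofFn]
    rfl
  have haid : a = id := List.ofFn_injective hofFn
  funext i
  simp [refl, hu, haid]

end UCox

/-- Any tuple in `Red_T(c)` other than `(s_1,…,s_n)` admits an elementary Hurwitz move
strictly decreasing total length; consequently `(s_1,…,s_n)` is the unique tuple of
minimal total length in `Red_T(c)`. -/
theorem hurwitz_length_reduction (n : ℕ) :
    (∀ t ∈ RedT n, t ≠ (fun i => sgen i) →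
      ∃ (i : ℕ) (hi : i + 1 < n) (t' : Fin n → UCox n),
        (t' = hmove n (UCox n) i hi t ∨ t' = hmoveInv n (UCox n) i hi t) ∧
        t' ∈ RedT n ∧
        ∑ j, wordLength (t' j) < ∑ j, wordLength (t j)) ∧
    (∀ t ∈ RedT n, (∀ t' ∈ RedT n, ∑ j, wordLength (t j) ≤ ∑ j, wordLength (t' j)) →
      t = fun i => sgen i) := by
  have reduction : ∀ t ∈ RedT n, t ≠ (fun i => sgen i) →
      ∃ (i : ℕ) (hi : i + 1 < n) (t' : Fin n → UCox n),
        (t' = hmove n (UCox n) i hi t ∨ t' = hmoveInv n (UCox n) i hi t) ∧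
        t' ∈ RedT n ∧
        ∑ j, wordLength (t' j) < ∑ j, wordLength (t j) := by
    intro t ht hne
    by_contra! hmin
    refine hne (UCox.eq_sgen_of_forall_wordLength_le ht (fun i hi => ?_) fun i hi => ?_)
    · by_contra! h
      exact (UCox.sum_wordLength_hmove_lt hi h).not_ge
        (hmin i hi _ (.inl rfl) (UCox.hmove_mem_RedT ht i hi))
    · by_contra! h
      exact (UCox.sum_wordLength_hmoveInv_lt hi h).not_ge
        (hmin i hi _ (.inr rfl) (UCox.hmoveInv_mem_RedT ht i hi))
  refine ⟨reduction, fun t ht hmin => ?_⟩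
  by_contra hne
  obtain ⟨_, _, t', -, ht', hlt⟩ := reduction t ht hne
  exact hlt.not_ge (hmin t' ht')
end

section
/- Let r be a conjugate of a generator f_j in the free group F_n that appears as an entry of some tuple β·(f_1,…,f_n) in the Hurwitz orbit of (f_1,…,f_n). If π(r) = s_j under the projection π: F_n → W_n (f_i ↦ s_i), then r = f_j. In other words, over each generator s_j of W_n, the fiber of the projection from R_g (reflections occurring in reduced decompositions of g = f_1⋯f_n) to T_c contains a unique element whose image is s_j when that image is a generator. -/
/-- The set `R_g` of entries of tuples in the Hurwitz orbit of `(f_1,…,f_n)`. -/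
def RgOrbit (n : ℕ) : Set (FreeGroup (Fin n)) :=
  { r | ∃ t : Fin n → FreeGroup (Fin n),
      Relation.EqvGen (hstep n (FreeGroup (Fin n))) (fun i => FreeGroup.of i) t ∧
      ∃ i, t i = r }

/-- Order automorphisms `T i` of the line commuting with the unit translation that pair the sides
`[p i, q (i + 1)]` and `[q i, p i]` of a polygon whose vertices `q 0 < p 0 < q 1 < ⋯ < q n` fill
one period. -/
structure SidePairing {n : ℕ} (T : Fin n → ℝ ≃o ℝ) (q : ℕ → ℝ) (p : Fin n → ℝ) : Prop where
  base : q 0 = 0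
  period : q n = 1
  lt_cusp : ∀ i : Fin n, q i < p i
  cusp_lt : ∀ i : Fin n, p i < q (i + 1)
  map_cusp : ∀ i, T i (p i) = p i
  map_side : ∀ i : Fin n, T i (q (i + 1)) = q i + 1
  map_add_one : ∀ i y, T i (y + 1) = T i y + 1

/-- The value of a signed letter. -/
def signedLetter {ι G : Type*} [Group G] (T : ι → G) (x : ι × Bool) : G :=
  cond x.2 (T x.1) (T x.1)⁻¹

/-- Modulo integer translation, `y` lies in the side belonging to the signed letter `x`, with
endpoints compared by `R`. -/
def InSide {n : ℕ} (R : ℝ → ℝ → Prop) (q : ℕ → ℝ) (p : Fin n → ℝ) (x : Fin n × Bool) (y : ℝ) :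
    Prop :=
  ∃ m : ℤ, R (cond x.2 (q x.1) (p x.1)) (y + m) ∧ R (y + m) (cond x.2 (p x.1) (q (x.1 + 1)))

/-- Modulo integer translation, `y` lies in the arc complementary to the side of `x⁻¹`. -/
def InDomain {n : ℕ} (R : ℝ → ℝ → Prop) (q : ℕ → ℝ) (p : Fin n → ℝ) (x : Fin n × Bool) (y : ℝ) :
    Prop :=
  ∃ m : ℤ, R (cond x.2 (q (x.1 + 1)) (p x.1)) (y + m) ∧
    R (y + m) (cond x.2 (p x.1 + 1) (q x.1 + 1))

lemma OrderIso.map_add_int_of_map_add_one {e : ℝ ≃o ℝ} (he : ∀ y, e (y + 1) = e y + 1) (y : ℝ)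
    (m : ℤ) : e (y + m) = e y + m := by
  induction m using Int.induction_on generalizing y with
  | zero => simp
  | succ k ih =>
    have := ih (y + 1)
    rw [he] at this
    push_cast at this ⊢
    rw [show y + ((k : ℝ) + 1) = y + 1 + k by ring, this]
    ring
  | pred k ih =>
    have := he (y + ((-(k : ℤ) - 1 : ℤ) : ℝ))
    have h2 := ih y
    push_cast at this h2 ⊢
    rw [show y + (-(k : ℝ) - 1) + 1 = y + -(k : ℝ) by ring, h2] at this
    linarith

namespace SidePairing

variable {n : ℕ} {T : Fin n → ℝ ≃o ℝ} {q : ℕ → ℝ} {p : Fin n → ℝ}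

lemma mono (S : SidePairing T q p) {i j : ℕ} (hij : i ≤ j) (hj : j ≤ n) : q i ≤ q j := by
  induction j, hij using Nat.le_induction with
  | base => exact le_rfl
  | succ k _ ih =>
    have h1 := S.lt_cusp ⟨k, hj⟩
    have h2 := S.cusp_lt ⟨k, hj⟩
    have := ih (by omega)
    simp only at h1 h2
    linarith

lemma nonneg (S : SidePairing T q p) {i : ℕ} (hi : i ≤ n) : 0 ≤ q i :=
  S.base ▸ S.mono (Nat.zero_le i) hi

lemma le_one (S : SidePairing T q p) {i : ℕ} (hi : i ≤ n) : q i ≤ 1 :=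
  S.period ▸ S.mono hi le_rfl

lemma cusp_pos (S : SidePairing T q p) (i : Fin n) : 0 < p i :=
  (S.nonneg i.2.le).trans_lt (S.lt_cusp i)

lemma cusp_lt_one (S : SidePairing T q p) (i : Fin n) : p i < 1 :=
  (S.cusp_lt i).trans_le (S.le_one i.2)

lemma lift_add_int (S : SidePairing T q p) (g : FreeGroup (Fin n)) (y : ℝ) (m : ℤ) :
    FreeGroup.lift T g (y + m) = FreeGroup.lift T g y + m := by
  refine OrderIso.map_add_int_of_map_add_one (fun y => ?_) y m
  induction g using FreeGroup.induction_on generalizing y with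
  | C1 => simp
  | of i => simpa using S.map_add_one i y
  | inv_of i _ =>
    rw [map_inv, FreeGroup.lift_apply_of]
    apply (T i).injective
    rw [S.map_add_one, RelIso.apply_inv_self, RelIso.apply_inv_self]
  | mul a b ha hb => simp only [map_mul, RelIso.mul_apply, hb, ha]

lemma inv_add_one (S : SidePairing T q p) (i : Fin n) (y : ℝ) :
    (T i)⁻¹ (y + 1) = (T i)⁻¹ y + 1 := by
  simpa using S.lift_add_int (FreeGroup.of i)⁻¹ y 1

lemma letter_add_int (S : SidePairing T q p) (x : Fin n × Bool) (y : ℝ) (m : ℤ) :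
    signedLetter T x (y + m) = signedLetter T x y + m := by
  have := S.lift_add_int (FreeGroup.mk [x]) y m
  simpa [FreeGroup.lift_mk, signedLetter] using this

lemma inv_cusp (S : SidePairing T q p) (i : Fin n) : (T i)⁻¹ (p i) = p i := by
  conv_lhs => rw [← S.map_cusp i]
  exact RelIso.inv_apply_self _ _

lemma inv_side (S : SidePairing T q p) (i : Fin n) : (T i)⁻¹ (q i + 1) = q (i + 1) := by
  rw [← S.map_side i]
  exact RelIso.inv_apply_self _ _

lemma inSide_of_inDomain (S : SidePairing T q p) {R : ℝ → ℝ → Prop}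
    (hR : ∀ (e : ℝ ≃o ℝ) a b, R a b → R (e a) (e b))
    (hR' : ∀ a b c, R a b → R (a + c) (b + c)) {x : Fin n × Bool} {y : ℝ}
    (h : InDomain R q p x y) : InSide R q p x (signedLetter T x y) := by
  obtain ⟨m, h1, h2⟩ := h
  have k1 := hR (signedLetter T x) _ _ h1
  have k2 := hR (signedLetter T x) _ _ h2
  rw [S.letter_add_int] at k1 k2
  obtain ⟨i, _ | _⟩ := x
  · refine ⟨m, ?_, ?_⟩
    · simpa [signedLetter, S.inv_cusp] using k1
    · simpa [signedLetter, S.inv_side] using k2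
  · refine ⟨m - 1, ?_, ?_⟩
    · have := hR' _ _ (-1) k1
      simpa [signedLetter, S.map_side, add_sub_assoc, sub_eq_add_neg, add_assoc] using this
    · have := hR' _ _ (-1) k2
      simpa [signedLetter, S.map_add_one, S.map_cusp, sub_eq_add_neg, add_assoc] using this

lemma inDomain_of_inSide (S : SidePairing T q p) {R : ℝ → ℝ → Prop}
    (hl : ∀ a b c, a ≤ b → R b c → R a c) (hr : ∀ a b c, R a b → b ≤ c → R a c)
    (hR' : ∀ a b c, R a b → R (a + c) (b + c)) {x z : Fin n × Bool}
    (hxz : x.1 = z.1 → x.2 = z.2) {y : ℝ} (h : InSide R q p z y) : InDomain R q p x y := by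
  obtain ⟨m, h1, h2⟩ := h
  have e : ∀ r : ℝ, r + ((m + 1 : ℤ) : ℝ) = r + m + 1 := fun r => by push_cast; ring
  obtain ⟨i, b⟩ := x
  obtain ⟨k, c⟩ := z
  have hk := S.lt_cusp k
  have hk' := S.cusp_lt k
  have hi := S.lt_cusp i
  have hi' := S.cusp_lt i
  have hk0 := S.nonneg k.2.le
  have hk1 := S.le_one k.2
  have hi0 := S.nonneg i.2.le
  have hi1 := S.le_one i.2
  rcases lt_trichotomy i k with hik | rfl | hik
  · have := S.mono (i := i + 1) (j := k) hik k.2.le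
    refine ⟨m, hl _ _ _ ?_ h1, hr _ _ _ h2 ?_⟩ <;> cases b <;> cases c <;>
      simp only [cond_true, cond_false] <;> linarith
  · obtain rfl : b = c := hxz rfl
    cases b
    · refine ⟨m, hl _ _ _ ?_ h1, hr _ _ _ h2 ?_⟩ <;> simp only [cond_false] <;> linarith
    · refine ⟨m + 1, hl _ _ _ ?_ (e y ▸ hR' _ _ 1 h1), hr _ _ _ (e y ▸ hR' _ _ 1 h2) ?_⟩ <;>
        simp only [cond_true] <;> linarith
  · have := S.mono (i := k + 1) (j := i) hik i.2.le
    refine ⟨m + 1, hl _ _ _ ?_ (e y ▸ hR' _ _ 1 h1), hr _ _ _ (e y ▸ hR' _ _ 1 h2) ?_⟩ <;>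
      cases b <;> cases c <;> simp only [cond_true, cond_false] <;> linarith

/-- Ping-pong: a reduced word moves `y` into the domain of any letter that may precede it. -/
lemma inDomain_word (S : SidePairing T q p) {R : ℝ → ℝ → Prop}
    (hR : R = (· ≤ ·) ∨ R = (· < ·)) {x : Fin n × Bool} {l : List (Fin n × Bool)}
    (hred : FreeGroup.IsReduced (x :: l)) {y : ℝ}
    (hy : ∀ z ∈ (x :: l).getLast?, InDomain R q p z y) :
    InDomain R q p x ((l.map (signedLetter T)).prod y) := by
  have hmap : ∀ (e : ℝ ≃o ℝ) a b, R a b → R (e a) (e b) := by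
    rcases hR with rfl | rfl <;> simp
  have hadd : ∀ a b c, R a b → R (a + c) (b + c) := by
    rcases hR with rfl | rfl <;> simp
  have hl : ∀ a b c, a ≤ b → R b c → R a c := by
    rcases hR with rfl | rfl
    · exact fun _ _ _ => le_trans
    · exact fun _ _ _ => lt_of_le_of_lt
  have hr : ∀ a b c, R a b → b ≤ c → R a c := by
    rcases hR with rfl | rfl
    · exact fun _ _ _ => le_trans
    · exact fun _ _ _ => lt_of_lt_of_le
  induction l generalizing x with
  | nil => simpa using hy x (by simp)
  | cons z l ih =>
    rw [FreeGroup.isReduced_cons_cons] at hred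
    have := ih hred.2 (by simpa using hy)
    rw [List.map_cons, List.prod_cons, RelIso.mul_apply]
    exact S.inDomain_of_inSide hl hr hadd hred.1 (S.inSide_of_inDomain hmap hadd this)

lemma inSide_word (S : SidePairing T q p) {R : ℝ → ℝ → Prop}
    (hR : R = (· ≤ ·) ∨ R = (· < ·)) {x : Fin n × Bool} {l : List (Fin n × Bool)}
    (hred : FreeGroup.IsReduced (x :: l)) {y : ℝ}
    (hy : ∀ z ∈ (x :: l).getLast?, InDomain R q p z y) :
    InSide R q p x (((x :: l).map (signedLetter T)).prod y) := by
  rw [List.map_cons, List.prod_cons, RelIso.mul_apply]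
  refine S.inSide_of_inDomain ?_ ?_ (S.inDomain_word hR hred hy) <;>
    rcases hR with rfl | rfl <;> simp

lemma inDomain_zero (S : SidePairing T q p) (x : Fin n × Bool) : InDomain (· ≤ ·) q p x 0 := by
  obtain ⟨i, b⟩ := x
  have := S.cusp_pos i
  have := S.cusp_lt_one i
  have := S.nonneg i.2.le
  have := S.le_one i.2
  refine ⟨1, ?_, ?_⟩ <;> cases b <;> simp <;> linarith

lemma inDomain_cusp_of_ne (S : SidePairing T q p) {x : Fin n × Bool} {j : Fin n} (h : x.1 ≠ j) :
    InDomain (· < ·) q p x (p j) := by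
  obtain ⟨i, b⟩ := x
  have hj := S.lt_cusp j
  have hj' := S.cusp_lt j
  have hi := S.lt_cusp i
  have hi' := S.cusp_lt i
  have := S.cusp_pos j
  have := S.cusp_lt_one j
  have := S.nonneg i.2.le
  have := S.le_one i.2
  rcases lt_or_gt_of_ne h with hik | hik
  · have := S.mono (i := i + 1) (j := j) hik j.2.le
    refine ⟨0, ?_, ?_⟩ <;> cases b <;> simp <;> linarith
  · have := S.mono (i := j + 1) (j := i) hik i.2.le
    refine ⟨1, ?_, ?_⟩ <;> cases b <;> simp <;> linarith

lemma inDomain_cusp (S : SidePairing T q p) (x : Fin n × Bool) (j : Fin n) :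
    InDomain (· ≤ ·) q p x (p j) := by
  by_cases h : x.1 = j
  · obtain ⟨i, b⟩ := x
    obtain rfl : i = j := h
    have := S.lt_cusp i
    have := S.cusp_lt i
    have := S.nonneg i.2.le
    have := S.le_one i.2
    cases b
    · exact ⟨0, by simp, by simp; linarith⟩
    · exact ⟨1, by simp; linarith, by simp⟩
  · obtain ⟨m, h1, h2⟩ := S.inDomain_cusp_of_ne h
    exact ⟨m, h1.le, h2.le⟩

/-- The chord from the base vertex to a cusp is not crossed by its translates. -/
lemma not_crossing (S : SidePairing T q p) (g : FreeGroup (Fin n)) (i : Fin n) (m : ℤ)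
    (h1 : FreeGroup.lift T g 0 < 0) (h2 : 0 < FreeGroup.lift T g (p i) + m)
    (h3 : FreeGroup.lift T g (p i) + m < p i + m)
    (h4 : p i + m < FreeGroup.lift T g 0 + 1) : False := by
  have hp := S.cusp_pos i
  have hp' := S.cusp_lt_one i
  obtain rfl : m = 0 := by
    have a : (-1 : ℝ) < m := by linarith
    have b : (m : ℝ) < 1 := by linarith
    have a : (-1 : ℤ) < m := by exact_mod_cast a
    have b : m < 1 := by exact_mod_cast b
    omega
  have hg : FreeGroup.lift T g = (g.toWord.map (signedLetter T)).prod := by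
    conv_lhs => rw [← FreeGroup.mk_toWord (x := g), FreeGroup.lift_mk]
    rfl
  have hred := FreeGroup.isReduced_toWord (x := g)
  rw [hg] at h1 h2 h3 h4
  generalize g.toWord = l at *
  cases l with
  | nil => simp at h1
  | cons x l =>
    obtain ⟨a, a1, a2⟩ := S.inSide_word (.inl rfl) hred fun z _ => S.inDomain_zero z
    obtain ⟨b, b1, b2⟩ := S.inSide_word (.inl rfl) hred fun z _ => S.inDomain_cusp z i
    generalize (((x :: l).map (signedLetter T)).prod 0) = u at *
    generalize (((x :: l).map (signedLetter T)).prod (p i)) = v at *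
    obtain ⟨k, c⟩ := x
    have hk := S.lt_cusp k
    have hk' := S.cusp_lt k
    have hi := S.lt_cusp i
    have hi' := S.cusp_lt i
    have hk0 := S.nonneg k.2.le
    have hk1 := S.le_one k.2
    simp only [Int.cast_zero, add_zero] at h2 h3 h4
    obtain ⟨u1, u2⟩ : 0 ≤ u + a ∧ u + a ≤ 1 := by
      cases c <;> simp only [cond_true, cond_false] at a1 a2 <;> constructor <;> linarith
    obtain ⟨v1, v2⟩ : 0 ≤ v + b ∧ v + b ≤ 1 := by
      cases c <;> simp only [cond_true, cond_false] at b1 b2 <;> constructor <;> linarith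
    obtain rfl : a = 1 := by
      have s : (0 : ℝ) < a := by linarith
      have t : (a : ℝ) < 2 := by linarith
      have s : 0 < a := by exact_mod_cast s
      have t : a < 2 := by exact_mod_cast t
      omega
    obtain rfl : b = 0 := by
      have s : (-1 : ℝ) < b := by linarith
      have t : (b : ℝ) < 1 := by linarith
      have s : -1 < b := by exact_mod_cast s
      have t : b < 1 := by exact_mod_cast t
      omega
    push_cast at a1 a2 b1 b2
    rcases lt_trichotomy i k with hik | rfl | hik
    · have := S.mono (i := i + 1) (j := k) hik k.2.le
      cases c <;> simp only [cond_true, cond_false] at a1 a2 b1 b2 <;> linarith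
    · cases c <;> simp only [cond_true, cond_false] at a1 a2 b1 b2 <;> linarith
    · have := S.mono (i := k + 1) (j := i) hik i.2.le
      cases c <;> simp only [cond_true, cond_false] at a1 a2 b1 b2 <;> linarith

end SidePairing

section Hurwitz

variable {n : ℕ} {G : Type*} [Group G] {i : ℕ} (hi : i + 1 < n) (t : Fin n → G)

lemma hmove_left : hmove n G i hi t ⟨i, by omega⟩ =
    t ⟨i, by omega⟩ * t ⟨i + 1, hi⟩ * (t ⟨i, by omega⟩)⁻¹ := by
  simp [hmove]

lemma hmove_right : hmove n G i hi t ⟨i + 1, hi⟩ = t ⟨i, by omega⟩ := by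
  simp [hmove]

lemma hmove_of_ne {k : Fin n} (h : (k : ℕ) ≠ i) (h' : (k : ℕ) ≠ i + 1) :
    hmove n G i hi t k = t k := by
  simp [hmove, h, h']

lemma map_hmove {H : Type*} [Group H] (f : G →* H) :
    (fun k => f (hmove n G i hi t k)) = hmove n H i hi fun k => f (t k) := by
  funext k
  unfold hmove
  split_ifs <;> simp

lemma closure_range_hmove :
    Subgroup.closure (Set.range (hmove n G i hi t)) = Subgroup.closure (Set.range t) := by
  have hmem : ∀ (s : Fin n → G) k, s k ∈ Subgroup.closure (Set.range s) :=
    fun s k => Subgroup.subset_closure ⟨k, rfl⟩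
  apply le_antisymm <;> rw [Subgroup.closure_le] <;> rintro _ ⟨k, rfl⟩
  · unfold hmove
    split_ifs
    · exact mul_mem (mul_mem (hmem t _) (hmem t _)) (inv_mem (hmem t _))
    · exact hmem t _
    · exact hmem t _
  · have hl := hmem (hmove n G i hi t) ⟨i, by omega⟩
    have hr := hmem (hmove n G i hi t) ⟨i + 1, hi⟩
    rw [hmove_left] at hl
    rw [hmove_right] at hr
    by_cases h : (k : ℕ) = i
    · exact (Fin.ext h : k = ⟨i, by omega⟩) ▸ hr
    by_cases h' : (k : ℕ) = i + 1
    · obtain rfl : k = ⟨i + 1, hi⟩ := Fin.ext h'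
      simpa [mul_assoc] using mul_mem (mul_mem (inv_mem hr) hl) hr
    · rw [← hmove_of_ne hi t h h']
      exact hmem _ _

end Hurwitz

namespace SidePairing

variable {n : ℕ} {T : Fin n → ℝ ≃o ℝ} {q : ℕ → ℝ} {p : Fin n → ℝ}

/-- A side pairing may be changed on two adjacent sides that keep their outer vertices. -/
lemma of_adjacent_change {T' : Fin n → ℝ ≃o ℝ} {i : ℕ} (hi : i + 1 < n) (S : SidePairing T q p)
    (hT : ∀ k : Fin n, (k : ℕ) ≠ i → (k : ℕ) ≠ i + 1 → T' k = T k)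
    (hper : ∀ k y, T' k (y + 1) = T' k y + 1) {a b c : ℝ}
    (h1 : q i < a) (h2 : a < c) (h3 : c < b) (h4 : b < q (i + 2))
    (h5 : T' ⟨i, by omega⟩ a = a) (h6 : T' ⟨i + 1, hi⟩ b = b)
    (h7 : T' ⟨i, by omega⟩ c = q i + 1) (h8 : T' ⟨i + 1, hi⟩ (q (i + 2)) = c + 1) :
    SidePairing T' (Function.update q (i + 1) c)
      (fun k => if (k : ℕ) = i then a else if (k : ℕ) = i + 1 then b else p k) := by
  have key : ∀ P : Fin n → Prop, P ⟨i, by omega⟩ → P ⟨i + 1, hi⟩ →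
      (∀ k : Fin n, (k : ℕ) ≠ i → (k : ℕ) ≠ i + 1 → P k) → ∀ k, P k := by
    intro P hP hP' hP'' k
    by_cases h : (k : ℕ) = i
    · exact (Fin.ext h : k = ⟨i, by omega⟩) ▸ hP
    by_cases h' : (k : ℕ) = i + 1
    · obtain rfl : k = ⟨i + 1, hi⟩ := Fin.ext h'
      exact hP'
    · exact hP'' k h h'
  refine ⟨?_, ?_, key _ ?_ ?_ ?_, key _ ?_ ?_ ?_, key _ ?_ ?_ ?_, key _ ?_ ?_ ?_, hper⟩
  · rw [Function.update_of_ne (by omega), S.base]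
  · rw [Function.update_of_ne (by omega), S.period]
  · simpa using h1
  · simpa using h3
  · intro k hk hk'
    simpa [hk, hk'] using S.lt_cusp k
  · simpa using h2
  · simpa [show i + 1 + 1 = i + 2 from rfl] using h4
  · intro k hk hk'
    simpa [hk, hk'] using S.cusp_lt k
  · simpa using h5
  · simpa using h6
  · intro k hk hk'
    simpa [hk, hk', hT k hk hk'] using S.map_cusp k
  · simpa using h7
  · simpa [show i + 1 + 1 = i + 2 from rfl] using h8
  · intro k hk hk'
    simpa [hk, hk', hT k hk hk'] using S.map_side k

lemma hmove {i : ℕ} (hi : i + 1 < n) (S : SidePairing T q p) :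
    SidePairing (hmove n _ i hi T)
      (Function.update q (i + 1) (T ⟨i, by omega⟩ (q (i + 2)) - 1))
      (fun k => if (k : ℕ) = i then T ⟨i, by omega⟩ (p ⟨i + 1, hi⟩) - 1
        else if (k : ℕ) = i + 1 then p ⟨i, by omega⟩ else p k) := by
  set A : Fin n := ⟨i, by omega⟩ with hA
  set B : Fin n := ⟨i + 1, hi⟩ with hB
  have a1 : q i < p A := S.lt_cusp A
  have a2 : p A < q (i + 1) := S.cusp_lt A
  have b1 : q (i + 1) < p B := S.lt_cusp B
  have b2 : p B < q (i + 2) := S.cusp_lt B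
  have s1 : T A (q (i + 1)) = q i + 1 := S.map_side A
  have s2 : T B (q (i + 2)) = q (i + 1) + 1 := S.map_side B
  have hle : q (i + 2) ≤ 1 := S.le_one hi
  have hsub : ∀ k y, T k (y - 1) = T k y - 1 := fun k y => by
    have := S.map_add_one k (y - 1)
    rw [sub_add_cancel] at this
    linarith
  have hisub : ∀ k y, (T k)⁻¹ (y - 1) = (T k)⁻¹ y - 1 := fun k y => by
    have := S.inv_add_one k (y - 1)
    rw [sub_add_cancel] at this
    linarith
  refine S.of_adjacent_change hi (fun k h h' => hmove_of_ne hi T h h') ?_ ?_ ?_ ?_ ?_ ?_ ?_ ?_ ?_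
  · intro k y
    unfold _root_.hmove
    split_ifs <;> simp [S.map_add_one, S.inv_add_one]
  · have := (T A).strictMono b1
    linarith
  · have := (T A).strictMono b2
    linarith
  · have : T A (q (i + 2)) < T A (p A + 1) :=
      (T A).strictMono (by have := S.cusp_pos A; linarith)
    rw [S.map_add_one, S.map_cusp] at this
    linarith
  · linarith
  · rw [hmove_left]
    simp [hisub, hsub, ← hA, ← hB, S.map_cusp]
  · rw [hmove_right]
    exact S.map_cusp A
  · rw [hmove_left]
    simp [hisub, hsub, ← hA, ← hB, s2, s1]
  · rw [hmove_right]
    simp [← hA]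

lemma of_hmove {i : ℕ} (hi : i + 1 < n) (S : SidePairing (_root_.hmove n _ i hi T) q p) :
    SidePairing T
      (Function.update q (i + 1) ((T ⟨i, by omega⟩)⁻¹ (q i) + 1))
      (fun k => if (k : ℕ) = i then p ⟨i + 1, hi⟩
        else if (k : ℕ) = i + 1 then (T ⟨i, by omega⟩)⁻¹ (p ⟨i, by omega⟩) + 1 else p k) := by
  set A : Fin n := ⟨i, by omega⟩ with hA
  set B : Fin n := ⟨i + 1, hi⟩ with hB
  have a1 : q i < p A := S.lt_cusp A
  have a2 : p A < q (i + 1) := S.cusp_lt A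
  have b1 : q (i + 1) < p B := S.lt_cusp B
  have b2 : p B < q (i + 2) := S.cusp_lt B
  have hr : _root_.hmove n _ i hi T B = T A := hmove_right hi T
  have hl : _root_.hmove n _ i hi T A = T A * T B * (T A)⁻¹ := hmove_left hi T
  have s1 : (T A * T B * (T A)⁻¹) (q (i + 1)) = q i + 1 := hl ▸ S.map_side A
  have s2 : T A (q (i + 2)) = q (i + 1) + 1 := hr ▸ S.map_side B
  have c1 : (T A * T B * (T A)⁻¹) (p A) = p A := hl ▸ S.map_cusp A
  have c2 : T A (p B) = p B := hr ▸ S.map_cusp B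
  have hadd : ∀ y, T A (y + 1) = T A y + 1 := fun y => hr ▸ S.map_add_one B y
  have hiadd : ∀ y, (T A)⁻¹ (y + 1) = (T A)⁻¹ y + 1 := fun y => hr ▸ S.inv_add_one B y
  have hB : T B = (T A)⁻¹ * (T A * T B * (T A)⁻¹) * T A := by group
  have hadd' : ∀ y, (T A * T B * (T A)⁻¹) (y + 1) = (T A * T B * (T A)⁻¹) y + 1 :=
    fun y => hl ▸ S.map_add_one A y
  have haddB : ∀ y, T B (y + 1) = T B y + 1 := fun y => by
    rw [hB, RelIso.mul_apply, RelIso.mul_apply, hadd, hadd', hiadd]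
    rfl
  have hpB : p B < q i + 1 := by
    have := S.nonneg (i := i) (by omega)
    have := S.cusp_lt_one B
    linarith
  refine S.of_adjacent_change hi (fun k h h' => (hmove_of_ne hi T h h').symm) ?_ ?_ ?_ ?_ ?_ ?_ ?_ ?_ ?_
  · intro k y
    by_cases h : (k : ℕ) = i
    · obtain rfl : k = A := Fin.ext h
      exact hadd y
    by_cases h' : (k : ℕ) = i + 1
    · obtain rfl : k = B := Fin.ext h'
      exact haddB y
    · rw [← hmove_of_ne hi T h h']
      exact S.map_add_one k y
  · linarith
  · rw [← (T A).lt_iff_lt, c2, hadd]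
    simpa using hpB
  · simpa using a1
  · rw [← (T A).lt_iff_lt, s2, hadd]
    simpa using a2
  · exact c2
  · change T B _ = _
    rw [haddB, add_left_inj]
    apply (T A).injective
    simpa using c1
  · simp [← hA, hadd]
  · change T B _ = _
    rw [hB, RelIso.mul_apply, RelIso.mul_apply, s2, hadd', s1, hiadd, hiadd]

end SidePairing

/-- The Möbius map of the unit interval fixing its endpoints with multiplier `c`. -/
noncomputable def unitMobius (c t : ℝ) : ℝ := c * t / (1 + (c - 1) * t)

section unitMobius

variable {c s t : ℝ}

lemma unitMobius_denom_pos (hc : 0 < c) (h0 : 0 ≤ t) (h1 : t < 1) : 0 < 1 + (c - 1) * t := by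
  nlinarith [mul_nonneg hc.le h0]

lemma unitMobius_mem (hc : 0 < c) (h0 : 0 ≤ t) (h1 : t < 1) :
    0 ≤ unitMobius c t ∧ unitMobius c t < 1 := by
  have hd := unitMobius_denom_pos hc h0 h1
  refine ⟨by unfold unitMobius; positivity, ?_⟩
  rw [unitMobius, div_lt_one hd]
  linarith

lemma unitMobius_lt (hc : 0 < c) (h0 : 0 ≤ s) (hst : s < t) (h1 : t < 1) :
    unitMobius c s < unitMobius c t := by
  rw [unitMobius, unitMobius, div_lt_div_iff₀ (unitMobius_denom_pos hc h0 (hst.trans h1))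
    (unitMobius_denom_pos hc (h0.trans hst.le) h1)]
  nlinarith [mul_pos hc (sub_pos.2 hst)]

lemma unitMobius_unitMobius_inv (hc : 0 < c) (h0 : 0 ≤ t) (h1 : t < 1) :
    unitMobius c (unitMobius c⁻¹ t) = t := by
  have hd := unitMobius_denom_pos (inv_pos.2 hc) h0 h1
  have hd' := unitMobius_denom_pos hc (unitMobius_mem (inv_pos.2 hc) h0 h1).1
    (unitMobius_mem (inv_pos.2 hc) h0 h1).2
  have hu : unitMobius c⁻¹ t * (1 + (c⁻¹ - 1) * t) = c⁻¹ * t := div_mul_cancel₀ _ hd.ne'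
  rw [unitMobius, div_eq_iff hd'.ne']
  generalize unitMobius c⁻¹ t = u at hu
  field_simp at hu
  linarith

/-- The extension of `unitMobius c` commuting with the unit translation. -/
noncomputable def periodicMobius (c y : ℝ) : ℝ := ⌊y⌋ + unitMobius c (Int.fract y)

lemma strictMono_periodicMobius (hc : 0 < c) : StrictMono (periodicMobius c) := by
  intro x y hxy
  have hx := unitMobius_mem hc (Int.fract_nonneg x) (Int.fract_lt_one x)
  have hy := unitMobius_mem hc (Int.fract_nonneg y) (Int.fract_lt_one y)
  unfold periodicMobius
  rcases (Int.floor_mono hxy.le).lt_or_eq with h | h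
  · have : (⌊x⌋ : ℝ) + 1 ≤ ⌊y⌋ := by exact_mod_cast h
    linarith
  · have : Int.fract x < Int.fract y := by
      rw [Int.fract, Int.fract, h]
      linarith
    rw [h]
    linarith [unitMobius_lt hc (Int.fract_nonneg x) this (Int.fract_lt_one y)]

lemma periodicMobius_inv (hc : 0 < c) :
    Function.RightInverse (periodicMobius c⁻¹) (periodicMobius c) := by
  intro y
  have h := unitMobius_mem (inv_pos.2 hc) (Int.fract_nonneg y) (Int.fract_lt_one y)
  have hf : ⌊periodicMobius c⁻¹ y⌋ = ⌊y⌋ := by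
    rw [Int.floor_eq_iff]
    unfold periodicMobius
    constructor <;> linarith
  have hf' : Int.fract (periodicMobius c⁻¹ y) = unitMobius c⁻¹ (Int.fract y) := by
    rw [Int.fract, hf, periodicMobius, add_sub_cancel_left]
  rw [periodicMobius, hf, hf',
    unitMobius_unitMobius_inv hc (Int.fract_nonneg y) (Int.fract_lt_one y), Int.floor_add_fract]

end unitMobius

lemma exists_parabolic (p : ℝ) {s : ℝ} (h0 : 0 < s) (h1 : s < 1 / 2) :
    ∃ e : ℝ ≃o ℝ, (∀ y, e (y + 1) = e y + 1) ∧ e p = p ∧ e (p + s) = p + 1 - s ∧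
      ∀ y, p < y → y < p + 1 → y < e y := by
  set c : ℝ := ((1 - s) / s) ^ 2 with hc
  have hc1 : 1 < c := by
    rw [hc, one_lt_sq_iff₀ (div_nonneg (by linarith) h0.le), lt_div_iff₀ h0]
    linarith
  have hc0 : 0 < c := by linarith
  refine ⟨((OrderIso.addRight (-p)).trans (StrictMono.orderIsoOfRightInverse _
    (strictMono_periodicMobius hc0) _ (periodicMobius_inv hc0))).trans (OrderIso.addRight p),
    ?_, ?_, ?_, ?_⟩
  · intro y
    simp only [OrderIso.trans_apply, OrderIso.addRight_apply,
      StrictMono.orderIsoOfRightInverse_apply, periodicMobius]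
    rw [show y + 1 + -p = y + -p + 1 by ring, Int.floor_add_one, Int.fract_add_one]
    push_cast
    ring
  · simp [periodicMobius, unitMobius]
  · have hf : ⌊s⌋ = 0 := Int.floor_eq_zero_iff.2 ⟨h0.le, by linarith⟩
    have hs : unitMobius c s = 1 - s := by
      rw [unitMobius, div_eq_iff (unitMobius_denom_pos hc0 h0.le (by linarith)).ne', hc]
      field_simp
      ring
    simp only [OrderIso.trans_apply, OrderIso.addRight_apply,
      StrictMono.orderIsoOfRightInverse_apply, periodicMobius]
    rw [show p + s + -p = s by ring, Int.fract, hf]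
    simp only [Int.cast_zero, sub_zero, hs]
    ring
  · intro y hy hy'
    have hf : ⌊y + -p⌋ = 0 := Int.floor_eq_zero_iff.2 ⟨by linarith, by linarith⟩
    simp only [OrderIso.trans_apply, OrderIso.addRight_apply,
      StrictMono.orderIsoOfRightInverse_apply, periodicMobius]
    rw [Int.fract, hf]
    simp only [Int.cast_zero, sub_zero, zero_add]
    have : y + -p < unitMobius c (y + -p) := by
      rw [unitMobius, lt_div_iff₀ (unitMobius_denom_pos hc0 (by linarith) (by linarith))]
      have hu : 0 < y + -p := by linarith
      have hv : 0 < 1 - (y + -p) := by linarith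
      nlinarith [mul_pos (mul_pos hu hv) (sub_pos.2 hc1)]
    linarith

lemma exists_sidePairing {n : ℕ} (hn : 2 ≤ n) :
    ∃ (T : Fin n → ℝ ≃o ℝ) (q : ℕ → ℝ) (p : Fin n → ℝ), SidePairing T q p ∧
      ∀ i y, p i < y → y < p i + 1 → y < T i y := by
  have hn' : (2 : ℝ) ≤ n := by exact_mod_cast hn
  have hpos : (0 : ℝ) < n := by linarith
  have hs : 1 / (2 * n : ℝ) < 1 / 2 := by
    rw [div_lt_div_iff₀ (by positivity) (by positivity)]
    linarith
  have hs0 : 0 < 1 / (2 * n : ℝ) := by positivity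
  have hstep : ∀ k : ℕ, ((k + 1 : ℕ) : ℝ) / n =
      (k : ℝ) / n + 1 / (2 * n : ℝ) + 1 / (2 * n : ℝ) := by
    intro k
    push_cast
    field_simp
    ring
  choose T h1 h2 h3 h4 using fun i : Fin n => exists_parabolic ((i : ℝ) / n + 1 / (2 * n)) hs0 hs
  refine ⟨T, fun k => (k : ℝ) / n, fun i => (i : ℝ) / n + 1 / (2 * n), ⟨by simp, by
    simp [hpos.ne'], fun i => by simpa using hpos, fun i => ?_, h2, fun i => ?_, h1⟩, h4⟩
  · simp only [hstep]
    linarith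
  · simp only [hstep, h3]
    ring

lemma List.exists_first_of_not_isChain {α : Type*} {R : α → α → Prop} {l : List α}
    (h : ¬ l.IsChain R) :
    ∃ A x y B, l = A ++ x :: y :: B ∧ ¬ R x y ∧ (A ++ [x]).IsChain R := by
  induction l with
  | nil => simp at h
  | cons a l ih =>
    cases l with
    | nil => simp at h
    | cons b l =>
      by_cases hab : R a b
      · obtain ⟨A, x, y, B, hl, hxy, hA⟩ := ih fun h' => h (by simp [hab, h'])
        refine ⟨a :: A, x, y, B, by simp [hl], hxy, ?_⟩
        cases A with
        | nil =>
          simp only [List.nil_append, List.cons.injEq] at hl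
          simpa [← hl.1] using hab
        | cons c A =>
          simp only [List.cons_append, List.cons.injEq] at hl
          simp only [List.cons_append, List.isChain_cons_cons]
          exact ⟨hl.1 ▸ hab, hA⟩
      · exact ⟨[], a, b, l, rfl, hab, by simp⟩

namespace SidePairing

variable {n : ℕ} {T : Fin n → ℝ ≃o ℝ} {q : ℕ → ℝ} {p : Fin n → ℝ}

lemma lift_mk_eq (l : List (Fin n × Bool)) :
    FreeGroup.lift T (FreeGroup.mk l) = (l.map (signedLetter T)).prod := by
  rw [FreeGroup.lift_mk]
  rfl

/-- The inverse of a reduced word that stays reduced when followed by `k` or its inverse moves the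
base vertex away from both sides belonging to `k`. -/
lemma inv_word_base (S : SidePairing T q p) {A : List (Fin n × Bool)} {x : Fin n × Bool}
    (hA : FreeGroup.IsReduced A) (hAx : (A ++ [x]).IsChain fun a b => a.1 ≠ b.1) :
    ∃ m : ℤ, q (x.1 + 1) ≤ (FreeGroup.lift T (FreeGroup.mk A))⁻¹ 0 + m ∧
      (FreeGroup.lift T (FreeGroup.mk A))⁻¹ 0 + m ≤ q x.1 + 1 := by
  have hk0 := S.nonneg x.1.2.le
  have hk1 := S.le_one x.1.2
  rcases List.eq_nil_or_concat A with rfl | ⟨A, y, rfl⟩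
  · refine ⟨1, ?_, ?_⟩ <;> simp [FreeGroup.lift_mk] <;> linarith
  · rw [List.concat_eq_append] at *
    have hyx : y.1 ≠ x.1 := by
      rw [List.append_assoc, List.singleton_append, List.isChain_append_cons_cons] at hAx
      exact hAx.2.1
    have hred : FreeGroup.IsReduced (FreeGroup.invRev (A ++ [y])) := by
      unfold FreeGroup.invRev FreeGroup.IsReduced at *
      rw [List.isChain_reverse, List.isChain_map]
      exact hA.imp fun a b h e => by simpa using (h e.symm).symm
    have heq : FreeGroup.invRev (A ++ [y]) = (y.1, !y.2) :: FreeGroup.invRev A := by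
      simp [FreeGroup.invRev]
    rw [← map_inv, FreeGroup.inv_mk, lift_mk_eq]
    rw [heq] at hred ⊢
    obtain ⟨m, h1, h2⟩ := S.inSide_word (.inl rfl) hred fun z _ => S.inDomain_zero z
    generalize (List.map (signedLetter T) ((y.1, !y.2) :: FreeGroup.invRev A)).prod 0 = v at *
    obtain ⟨i, b⟩ := y
    have hi := S.lt_cusp i
    have hi' := S.cusp_lt i
    have hi0 := S.nonneg i.2.le
    have hi1 := S.le_one i.2
    rcases lt_or_gt_of_ne hyx with hlt | hlt
    · have := S.mono (i := i + 1) (j := x.1) hlt x.1.2.le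
      refine ⟨m + 1, ?_, ?_⟩ <;> cases b <;> push_cast <;>
        simp only [Bool.not_true, Bool.not_false, cond_true, cond_false] at h1 h2 <;> linarith
    · have := S.mono (i := x.1 + 1) (j := i) hlt i.2.le
      refine ⟨m, ?_, ?_⟩ <;> cases b <;>
        simp only [Bool.not_true, Bool.not_false, cond_true, cond_false] at h1 h2 <;> linarith

end SidePairing

section Tuple

variable {n : ℕ} {T : Fin n → ℝ ≃o ℝ} {q : ℕ → ℝ} {p : Fin n → ℝ}
  {t : Fin n → FreeGroup (Fin n)} {q' : ℕ → ℝ} {p' : Fin n → ℝ}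

lemma SidePairing.not_crossing_conj (S : SidePairing T q p)
    (S' : SidePairing (fun k => FreeGroup.lift T (t k)) q' p')
    (ht : Function.Surjective (FreeGroup.lift t)) (i : Fin n) (u g : FreeGroup (Fin n))
    {a b : ℝ} {M N : ℤ} (ha : FreeGroup.lift T u a = M) (hb : FreeGroup.lift T u b = p' i + N)
    (h1 : FreeGroup.lift T g a < a) (h2 : a < FreeGroup.lift T g b)
    (h3 : FreeGroup.lift T g b < b) (h4 : b < FreeGroup.lift T g a + 1) : False := by
  obtain ⟨h, hh⟩ := ht (u * g * u⁻¹)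
  have hcomp : ∀ h, FreeGroup.lift (fun k => FreeGroup.lift T (t k)) h =
      FreeGroup.lift T (FreeGroup.lift t h) := by
    intro h
    have : FreeGroup.lift (fun k => FreeGroup.lift T (t k)) =
        (FreeGroup.lift T).comp (FreeGroup.lift t) := by
      ext1 k
      simp
    rw [this]
    rfl
  have hconj : ∀ y, FreeGroup.lift T (u * g * u⁻¹) (FreeGroup.lift T u y) =
      FreeGroup.lift T u (FreeGroup.lift T g y) := fun y => by
    simp [RelIso.mul_apply]
  have ka := hconj a
  have kb := hconj b
  rw [ha, ← zero_add (M : ℝ), S.lift_add_int] at ka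
  rw [hb, S.lift_add_int] at kb
  have k1 := (FreeGroup.lift T u).strictMono h1
  have k2 := (FreeGroup.lift T u).strictMono h2
  have k3 := (FreeGroup.lift T u).strictMono h3
  have k4 := (FreeGroup.lift T u).strictMono h4
  have e := S.lift_add_int u (FreeGroup.lift T g a) 1
  rw [Int.cast_one] at e
  refine S'.not_crossing h i (N - M) ?_ ?_ ?_ ?_ <;> rw [hcomp, hh] <;> push_cast <;> linarith

/-- The word carrying a standard cusp to a cusp of the tuple `t` has no repeated letters. -/
lemma SidePairing.isChain_ne_toWord (S : SidePairing T q p)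
    (hup : ∀ i y, p i < y → y < p i + 1 → y < T i y)
    (S' : SidePairing (fun k => FreeGroup.lift T (t k)) q' p')
    (ht : Function.Surjective (FreeGroup.lift t)) {i j : Fin n} {w : FreeGroup (Fin n)} {m : ℤ}
    (hp : p' i = FreeGroup.lift T w (p j) + m) (hlast : ∀ z ∈ w.toWord.getLast?, z.1 ≠ j) :
    w.toWord.IsChain fun a b => a.1 ≠ b.1 := by
  by_contra hchain
  obtain ⟨A, x, y, B, hl, hxy, hA⟩ := List.exists_first_of_not_isChain hchain
  have hred := FreeGroup.isReduced_toWord (x := w)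
  have hw : FreeGroup.lift T w (p j) = FreeGroup.lift T (FreeGroup.mk A)
      (signedLetter T x (signedLetter T y ((B.map (signedLetter T)).prod (p j)))) := by
    conv_lhs => rw [← FreeGroup.mk_toWord (x := w), hl, lift_mk_eq]
    rw [lift_mk_eq, List.map_append, List.prod_append, List.map_cons, List.map_cons,
      List.prod_cons, List.prod_cons]
    rfl
  rw [hl] at hred hlast
  have hyB : FreeGroup.IsReduced (y :: B) := hred.infix ⟨A ++ [x], [], by simp⟩
  obtain rfl : x = y := by
    have := hred.infix (L₁ := [x, y]) ⟨A, B, by simp⟩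
    simp only [FreeGroup.isReduced_cons_cons] at this
    exact Prod.ext (not_not.1 hxy) (this.1 (not_not.1 hxy))
  obtain ⟨M, a1, a2⟩ := S.inv_word_base (hred.infix ⟨[], x :: x :: B, by simp⟩) hA
  obtain ⟨N, d1, d2⟩ := S.inDomain_word (.inr rfl) hyB (y := p j) fun z hz =>
    S.inDomain_cusp_of_ne (hlast z (by
      rw [List.getLast?_append_of_ne_nil _ (by simp)]
      simpa using hz))
  set U := FreeGroup.lift T (FreeGroup.mk A) with hU
  generalize (B.map (signedLetter T)).prod (p j) = d₀ at *
  have hUa : U (U⁻¹ 0 + M) = M := by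
    rw [hU, S.lift_add_int, ← hU, RelIso.apply_inv_self, zero_add]
  obtain ⟨k, b⟩ := x
  have hk := S.lt_cusp k
  have hk' := S.cusp_lt k
  generalize U⁻¹ 0 + (M : ℝ) = a at *
  have hinv : FreeGroup.lift T (FreeGroup.of k)⁻¹ = (T k)⁻¹ := by simp
  have up := hup k
  have down : ∀ y, p k < y → y < p k + 1 → (T k)⁻¹ y < y := fun y h h' => by
    rw [← (T k).lt_iff_lt, RelIso.apply_inv_self]
    exact up y h h'
  have inv_lower : ∀ y, p k < y → p k < (T k)⁻¹ y := fun y h => by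
    have := (T k)⁻¹.strictMono h
    rwa [S.inv_cusp] at this
  have upper : ∀ y, y < p k + 1 → T k y < p k + 1 := fun y h => by
    have := (T k).strictMono h
    rwa [S.map_add_one, S.map_cusp] at this
  have ha1 := down a (by simp only at a1; linarith) (by simp only at a2; linarith)
  have ha2 := inv_lower a (by simp only at a1; linarith)
  have hlet := S.letter_add_int (k, b)
  cases b
  · simp only [signedLetter, cond_false] at d1 d2 hw a1 a2 hlet
    set d := d₀ + (N : ℝ) with hd
    have e1 := inv_lower _ d1
    have e2 : (T k)⁻¹ d < q (k + 1) := by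
      rw [← S.inv_side k]
      exact (T k)⁻¹.strictMono d2
    have e3 := inv_lower _ e1
    have e4 := down _ e1 (by linarith [S.cusp_pos k, S.le_one (i := k + 1) k.2])
    have e5 := inv_lower _ e3
    have e6 := down _ e3 (by linarith [S.cusp_pos k, S.le_one (i := k + 1) k.2])
    have e7 : (T k)⁻¹ ((T k)⁻¹ d) < (T k)⁻¹ a := (T k)⁻¹.strictMono (by linarith)
    refine S.not_crossing_conj S' ht i (FreeGroup.mk A) (FreeGroup.of k)⁻¹ (M := M)
      (N := N + 1 - m) (a := a) (b := (T k)⁻¹ ((T k)⁻¹ d) + 1) hUa ?_ ?_ ?_ ?_ ?_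
    · rw [hp, hw, hd, hlet, hlet]
      have := S.lift_add_int (FreeGroup.mk A) ((T k)⁻¹ ((T k)⁻¹ d₀)) (N + 1)
      push_cast at this ⊢
      rw [add_assoc ((T k)⁻¹ ((T k)⁻¹ d₀)), this]
      ring
    · rw [hinv]
      exact ha1
    · rw [hinv, S.inv_add_one]
      linarith
    · rw [hinv, S.inv_add_one]
      linarith
    · rw [hinv]
      linarith
  · simp only [signedLetter, cond_true] at d1 d2 hw a1 a2 hlet
    set d := d₀ + (N : ℝ) with hd
    have e1 : q k + 1 < T k d := by
      rw [← S.map_side k]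
      exact (T k).strictMono d1
    have e2 := upper _ d2
    have e3 := upper _ e2
    have e4 := up (T k d) (by linarith) e2
    refine S.not_crossing_conj S' ht i (FreeGroup.mk A) (FreeGroup.of k)⁻¹ (M := M)
      (N := N - m) (a := a) (b := T k (T k d)) hUa ?_ ?_ ?_ ?_ ?_
    · rw [hp, hw, hd, hlet, hlet, S.lift_add_int]
      push_cast
      ring
    · rw [hinv]
      exact ha1
    · rw [hinv, RelIso.inv_apply_self]
      linarith
    · rw [hinv, RelIso.inv_apply_self]
      linarith
    · rw [hinv]
      linarith

/-- The invariant of the Hurwitz orbit: the entries of `t` generate the free group, act by a side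
pairing, and their cusps are translates of the standard ones. -/
def HasCusps (T : Fin n → ℝ ≃o ℝ) (p : Fin n → ℝ) (t : Fin n → FreeGroup (Fin n)) : Prop :=
  Subgroup.closure (Set.range t) = ⊤ ∧
    ∃ q' p', SidePairing (fun k => FreeGroup.lift T (t k)) q' p' ∧
      ∀ k, ∃ (w : FreeGroup (Fin n)) (j : Fin n) (m : ℤ),
        t k = w * FreeGroup.of j * w⁻¹ ∧ p' k = FreeGroup.lift T w (p j) + m

lemma hasCusps_of (S : SidePairing T q p) : HasCusps T p fun i => FreeGroup.of i :=
  ⟨FreeGroup.closure_range_of _, q, p, by simpa using S, fun k => ⟨1, k, 0, by simp, by simp⟩⟩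

lemma HasCusps.hmove (S : SidePairing T q p) {i : ℕ} (hi : i + 1 < n) (h : HasCusps T p t) :
    HasCusps T p (hmove n _ i hi t) := by
  obtain ⟨hc, q', p', S', hw⟩ := h
  refine ⟨(closure_range_hmove hi t).trans hc, _, _,
    (map_hmove hi t (FreeGroup.lift T)).symm ▸ S'.hmove hi, fun k => ?_⟩
  by_cases h : (k : ℕ) = i
  · obtain ⟨w, j, m, h1, h2⟩ := hw ⟨i + 1, hi⟩
    refine ⟨t ⟨i, Nat.lt_of_succ_lt hi⟩ * w, j, m - 1, ?_, ?_⟩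
    · rw [(Fin.ext h : k = ⟨i, Nat.lt_of_succ_lt hi⟩), hmove_left, h1]
      group
    · simp only [h, if_true, h2, S.lift_add_int, map_mul, RelIso.mul_apply]
      push_cast
      ring
  by_cases h' : (k : ℕ) = i + 1
  · obtain ⟨w, j, m, h1, h2⟩ := hw ⟨i, Nat.lt_of_succ_lt hi⟩
    refine ⟨w, j, m, ?_, by simp [h', h2]⟩
    rw [(Fin.ext h' : k = ⟨i + 1, hi⟩), hmove_right, h1]
  · obtain ⟨w, j, m, h1, h2⟩ := hw k
    exact ⟨w, j, m, by rw [hmove_of_ne hi t h h', h1], by simp [h, h', h2]⟩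

lemma HasCusps.of_hmove (S : SidePairing T q p) {i : ℕ} (hi : i + 1 < n)
    (h : HasCusps T p (_root_.hmove n _ i hi t)) : HasCusps T p t := by
  obtain ⟨hc, q', p', S', hw⟩ := h
  rw [map_hmove] at S'
  refine ⟨(closure_range_hmove hi t).symm.trans hc, _, _, S'.of_hmove hi, fun k => ?_⟩
  by_cases h : (k : ℕ) = i
  · obtain ⟨w, j, m, h1, h2⟩ := hw ⟨i + 1, hi⟩
    refine ⟨w, j, m, ?_, by simp [h, h2]⟩
    rw [(Fin.ext h : k = ⟨i, Nat.lt_of_succ_lt hi⟩), ← h1, hmove_right]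
  by_cases h' : (k : ℕ) = i + 1
  · obtain ⟨w, j, m, h1, h2⟩ := hw ⟨i, Nat.lt_of_succ_lt hi⟩
    refine ⟨(t ⟨i, Nat.lt_of_succ_lt hi⟩)⁻¹ * w, j, m + 1, ?_, ?_⟩
    · rw [hmove_left] at h1
      have e : ∀ a b : FreeGroup (Fin n), b = a⁻¹ * (a * b * a⁻¹) * a := fun a b => by group
      rw [(Fin.ext h' : k = ⟨i + 1, hi⟩), e (t ⟨i, Nat.lt_of_succ_lt hi⟩) (t ⟨i + 1, hi⟩), h1]
      group
    · have := S.lift_add_int (t ⟨i, Nat.lt_of_succ_lt hi⟩)⁻¹ (FreeGroup.lift T w (p j)) m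
      rw [map_inv] at this
      simp only [h', h2, map_mul, map_inv, RelIso.mul_apply, this]
      simp [add_assoc]
  · obtain ⟨w, j, m, h1, h2⟩ := hw k
    exact ⟨w, j, m, by rw [← h1, hmove_of_ne hi t h h'], by simp [h, h', h2]⟩

lemma HasCusps.of_eqvGen (S : SidePairing T q p)
    (h : Relation.EqvGen (hstep n (FreeGroup (Fin n))) (fun i => FreeGroup.of i) t) :
    HasCusps T p t := by
  have key : ∀ {a b}, Relation.EqvGen (hstep n (FreeGroup (Fin n))) a b →
      (HasCusps T p a ↔ HasCusps T p b) := by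
    intro a b hab
    induction hab with
    | rel a b h =>
      obtain ⟨i, hi, rfl⟩ := h
      exact ⟨.hmove S hi, .of_hmove S hi⟩
    | refl => exact Iff.rfl
    | symm _ _ _ ih => exact ih.symm
    | trans _ _ _ _ _ ih ih' => exact ih.trans ih'
  exact (key h).1 (hasCusps_of S)

/-- The conjugating word of a cusp can be chosen not to end in the letter it conjugates. -/
lemma SidePairing.exists_reduced_conj (S : SidePairing T q p) (w : FreeGroup (Fin n)) (j : Fin n) :
    ∃ v : FreeGroup (Fin n), v * FreeGroup.of j * v⁻¹ = w * FreeGroup.of j * w⁻¹ ∧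
      FreeGroup.lift T v (p j) = FreeGroup.lift T w (p j) ∧
      ∀ z ∈ v.toWord.getLast?, z.1 ≠ j := by
  induction hk : w.toWord.length using Nat.strong_induction_on generalizing w with
  | _ k ih =>
    by_cases hw : ∀ z ∈ w.toWord.getLast?, z.1 ≠ j
    · exact ⟨w, rfl, rfl, hw⟩
    push Not at hw
    obtain ⟨⟨i, b⟩, hz, rfl⟩ := hw
    obtain ⟨l, hl⟩ := List.getLast?_eq_some_iff.1 hz
    have hlen : (FreeGroup.mk l).toWord.length < k := by
      have h1 : (FreeGroup.mk l).toWord.length ≤ l.length := FreeGroup.norm_mk_le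
      have h2 : w.toWord.length = l.length + 1 := by simp [hl]
      omega
    obtain ⟨v, h1, h2, h3⟩ := ih _ hlen (FreeGroup.mk l) rfl
    have hw : w = FreeGroup.mk l * FreeGroup.mk [(i, b)] := by
      conv_lhs => rw [← FreeGroup.mk_toWord (x := w), hl]
      rw [FreeGroup.mul_mk]
    refine ⟨v, h1.trans ?_, h2.trans ?_, h3⟩
    · cases b
      · have : FreeGroup.mk [(i, false)] = (FreeGroup.of i)⁻¹ := rfl
        rw [hw, this]
        group
      · have : FreeGroup.mk [(i, true)] = FreeGroup.of i := rfl
        rw [hw, this]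
        group
    · cases b
      · simp [hw, FreeGroup.lift_mk, RelIso.mul_apply, S.inv_cusp]
      · simp [hw, FreeGroup.lift_mk, RelIso.mul_apply, S.map_cusp]

end Tuple

section NormalForm

variable {n : ℕ}

/-- Left multiplication by a generator on alternating words. -/
def toggleHead (i : Fin n) (l : { l : List (Fin n) // l.IsChain (· ≠ ·) }) :
    { l : List (Fin n) // l.IsChain (· ≠ ·) } :=
  if h : l.1.head? = some i then ⟨l.1.tail, l.2.tail⟩
  else ⟨i :: l.1, List.isChain_cons.2 ⟨fun _ hy e => h (e ▸ hy), l.2⟩⟩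

lemma toggleHead_toggleHead (i : Fin n) (l : { l : List (Fin n) // l.IsChain (· ≠ ·) }) :
    toggleHead i (toggleHead i l) = l := by
  obtain ⟨l, hl⟩ := l
  apply Subtype.ext
  by_cases h : l.head? = some i
  · obtain ⟨l', rfl⟩ := List.head?_eq_some_iff.1 h
    have : l'.head? ≠ some i := fun e => (List.isChain_cons.1 hl).1 i e rfl
    simp [toggleHead, this]
  · simp [toggleHead, h]

/-- The action of the universal Coxeter group on alternating words. -/
def coxAction (n : ℕ) : UCox n →* Equiv.Perm { l : List (Fin n) // l.IsChain (· ≠ ·) } :=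
  PresentedGroup.toGroup
    (f := fun i => Function.Involutive.toPerm (toggleHead i) (toggleHead_toggleHead i)) (by
      rintro _ ⟨i, rfl⟩
      ext1 l
      simp only [map_mul, FreeGroup.lift_apply_of, Equiv.Perm.mul_apply, Equiv.Perm.one_apply]
      exact toggleHead_toggleHead i l)

lemma coxAction_prod_nil {l : List (Fin n)} (hl : l.IsChain (· ≠ ·)) :
    coxAction n (l.map sgen).prod ⟨[], List.isChain_nil⟩ = ⟨l, hl⟩ := by
  induction l with
  | nil => simp
  | cons i l ih =>
    have hi : l.head? ≠ some i := fun e => (List.isChain_cons.1 hl).1 i e rfl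
    rw [List.map_cons, List.prod_cons, map_mul, Equiv.Perm.mul_apply, ih hl.tail, sgen, coxAction,
      PresentedGroup.toGroup.of]
    change toggleHead i ⟨l, hl.tail⟩ = _
    simp [toggleHead, hi]

lemma eq_of_prod_sgen_eq {l l' : List (Fin n)} (hl : l.IsChain (· ≠ ·)) (hl' : l'.IsChain (· ≠ ·))
    (h : (l.map sgen).prod = (l'.map sgen).prod) : l = l' := by
  have := coxAction_prod_nil hl
  rw [h, coxAction_prod_nil hl'] at this
  exact (congrArg Subtype.val this).symm

lemma sgen_inv (i : Fin n) : (sgen i)⁻¹ = sgen i := by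
  rw [inv_eq_iff_mul_eq_one]
  exact PresentedGroup.one_of_mem (rels := coxRels n) ⟨i, rfl⟩

lemma pr_eq_prod (w : FreeGroup (Fin n)) :
    pr n w = ((w.toWord.map Prod.fst).map sgen).prod := by
  conv_lhs => rw [← FreeGroup.mk_toWord (x := w), pr, FreeGroup.lift_mk]
  rw [List.map_map]
  congr 2
  funext ⟨i, b⟩
  cases b <;> simp [sgen_inv]

lemma inv_prod_map_sgen (l : List (Fin n)) : (l.map sgen).prod⁻¹ = (l.reverse.map sgen).prod := by
  rw [List.prod_inv_reverse, List.map_map, List.map_reverse]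
  congr 3
  funext i
  exact sgen_inv i

lemma eq_one_of_pr_conj_eq {w : FreeGroup (Fin n)} {i j : Fin n}
    (hw : w.toWord.IsChain fun a b => a.1 ≠ b.1) (hlast : ∀ z ∈ w.toWord.getLast?, z.1 ≠ i)
    (h : pr n (w * FreeGroup.of i * w⁻¹) = sgen j) : w = 1 ∧ i = j := by
  set l := w.toWord.map Prod.fst with hl
  have hchain : l.IsChain (· ≠ ·) := (List.isChain_map _).2 hw
  have hlast' : ∀ z ∈ l.getLast?, z ≠ i := by
    intro z hz
    rw [hl, List.getLast?_map] at hz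
    obtain ⟨y, hy, rfl⟩ := Option.mem_map.1 hz
    exact hlast y hy
  have hrev : (i :: l.reverse).IsChain (· ≠ ·) := by
    rw [List.isChain_cons, List.isChain_reverse]
    refine ⟨fun z hz => ?_, hchain.imp fun _ _ => Ne.symm⟩
    rw [List.head?_reverse] at hz
    exact (hlast' z hz).symm
  have hfull : (l ++ i :: l.reverse).IsChain (· ≠ ·) := by
    refine List.isChain_append.2 ⟨hchain, hrev, fun z hz y hy => ?_⟩
    obtain rfl : i = y := by simpa using hy
    exact hlast' z hz
  have hprod : ((l ++ i :: l.reverse).map sgen).prod = ([j].map sgen).prod := by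
    rw [map_mul, map_mul, map_inv, pr_eq_prod w, ← hl, inv_prod_map_sgen,
      show pr n (FreeGroup.of i) = sgen i by simp [pr]] at h
    simpa [mul_assoc] using h
  have heq := eq_of_prod_sgen_eq hfull (List.isChain_singleton j) hprod
  have hnil : l = [] := by
    have := congrArg List.length heq
    simp only [List.length_append, List.length_cons, List.length_reverse, List.length_nil] at this
    exact List.eq_nil_of_length_eq_zero (by omega)
  refine ⟨FreeGroup.toWord_eq_nil_iff.1 (List.map_eq_nil_iff.1 hnil), ?_⟩
  simpa [hnil] using heq

end NormalForm

/-- If `r ∈ R_g` projects to the generator `s_j` of `W_n`, then `r = f_j`. -/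
theorem fiber_over_generator (n : ℕ) (r : FreeGroup (Fin n)) (hr : r ∈ RgOrbit n)
    (j : Fin n) (hpr : pr n r = sgen j) : r = FreeGroup.of j := by
  obtain ⟨t, ht, i, rfl⟩ := hr
  rcases le_or_gt 2 n with hn | hn
  · obtain ⟨T, q, p, S, hup⟩ := exists_sidePairing hn
    obtain ⟨hc, q', p', S', hw⟩ := HasCusps.of_eqvGen S ht
    obtain ⟨w, k, m, h1, h2⟩ := hw i
    obtain ⟨v, e1, e2, hlast⟩ := S.exists_reduced_conj w k
    rw [← e1] at h1
    rw [← e2] at h2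
    rw [h1] at hpr
    obtain ⟨rfl, rfl⟩ := eq_one_of_pr_conj_eq (S.isChain_ne_toWord hup S'
      (FreeGroup.lift_surjective_iff_closure_range_eq_top.2 hc) h2 hlast) hlast hpr
    simpa using h1
  · have key : ∀ {a b}, Relation.EqvGen (hstep n (FreeGroup (Fin n))) a b → a = b := by
      intro a b hab
      induction hab with
      | rel a b h =>
        obtain ⟨i, hi, -⟩ := h
        omega
      | refl => rfl
      | symm _ _ _ ih => exact ih.symm
      | trans _ _ _ _ _ ih ih' => exact ih.trans ih'
    rw [← key ht]
    exact congrArg _ (Fin.ext (by omega))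
end
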